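/- If f : ℝ^p → ℝ is differentiable and its gradient has constant Euclidean norm, i.e., there is a constant c ≥ 0 with ‖∇f(w)‖ = c for all w ∈ ℝ^p, then f is an affine function: there exist a vector a ∈ ℝ^p and a scalar b such that f(w) = ⟪a, w⟫ + b for all w. -/

import Mathlib

open RealInnerProductSpace

section ConstantGradientNorm

open Filter Topology

variable {E : Type*} [NormedAddCommGroup E] [InnerProductSpace ℝ E]

theorem norm_sub_smul_le {e : E} (he : ‖e‖ = 1) (w : E) {r : ℝ} (hr : 0 < r) :
    ‖w - r • e‖ ≤ r - ⟪e, w⟫ + ‖w‖ ^ 2 / (2 * r) := by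
  have hsq : ‖w - r • e‖ ^ 2 = ‖w‖ ^ 2 - 2 * (r * ⟪e, w⟫) + r ^ 2 := by
    rw [norm_sub_sq_real, inner_smul_right, norm_smul, he, real_inner_comm, mul_one,
      Real.norm_eq_abs, sq_abs]
  have hrhs : r - ⟪e, w⟫ + ‖w‖ ^ 2 / (2 * r) = (‖w - r • e‖ ^ 2 + r ^ 2) / (2 * r) := by
    rw [hsq]
    field_simp
    ring
  rw [hrhs, le_div_iff₀ (by positivity)]
  nlinarith [sq_nonneg (‖w - r • e‖ - r)]

variable [CompleteSpace E] {f : E → ℝ} {c : ℝ}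

theorem sub_le_of_norm_gradient_eq (hf : Differentiable ℝ f) (hgrad : ∀ w, ‖gradient f w‖ = c)
    (x y : E) : f y - f x ≤ c * ‖y - x‖ := by
  refine (le_abs_self _).trans ?_
  rw [← Real.norm_eq_abs]
  refine convex_univ.norm_image_sub_le_of_norm_fderiv_le (𝕜 := ℝ) (fun z _ => hf z)
    (fun z _ => ?_) (Set.mem_univ x) (Set.mem_univ y)
  rw [← hgrad z, gradient, LinearIsometryEquiv.norm_map]

/-- A function whose gradient is longer than `d` cannot have a local maximum after subtracting
`d` times the distance to a point. -/
theorem not_isLocalMax_sub_mul_norm {y : E} (hf : DifferentiableAt ℝ f y) {d : ℝ} (hd : 0 ≤ d)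
    (hdy : d < ‖gradient f y‖) (x : E) : ¬ IsLocalMax (fun z => f z - d * ‖z - x‖) y := by
  intro hmax
  set v := gradient f y with hv
  have hline : HasDerivAt (fun h : ℝ => f (y + h • v)) (‖v‖ ^ 2) 0 := by
    have h1 : HasDerivAt (fun h : ℝ => y + h • v) v 0 := by
      simpa using ((hasDerivAt_id (0 : ℝ)).smul_const v).const_add y
    have h2 : HasFDerivAt f (InnerProductSpace.toDual ℝ E v) (y + (0 : ℝ) • v) := by
      rw [zero_smul, add_zero]
      exact hf.hasGradientAt.hasFDerivAt
    have h3 := h2.comp_hasDerivAt (0 : ℝ) h1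
    rw [InnerProductSpace.toDual_apply_apply, real_inner_self_eq_norm_sq] at h3
    exact h3
  have hslope := (hasDerivAt_iff_tendsto_slope_zero.1 hline).mono_left
    (nhdsWithin_mono 0 (fun h (hh : h ∈ Set.Ioi (0 : ℝ)) => ne_of_gt hh))
  have hcont : Tendsto (fun h : ℝ => y + h • v) (𝓝[>] 0) (𝓝 y) := by
    have : Continuous fun h : ℝ => y + h • v := by fun_prop
    simpa using (this.tendsto 0).mono_left nhdsWithin_le_nhds
  have hle : ‖v‖ ^ 2 ≤ d * ‖v‖ := by
    refine le_of_tendsto hslope ?_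
    filter_upwards [hcont.eventually hmax, self_mem_nhdsWithin] with h hh (hpos : 0 < h)
    have htri : ‖y + h • v - x‖ ≤ ‖y - x‖ + h * ‖v‖ := by
      calc ‖y + h • v - x‖ = ‖(y - x) + h • v‖ := by congr 1; abel
        _ ≤ ‖y - x‖ + ‖h • v‖ := norm_add_le _ _
        _ = ‖y - x‖ + h * ‖v‖ := by rw [norm_smul, Real.norm_of_nonneg hpos.le]
    have := mul_le_mul_of_nonneg_left htri hd
    simp only [zero_add, zero_smul, add_zero, smul_eq_mul]
    rw [inv_mul_le_iff₀ hpos]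
    linarith
  nlinarith

theorem exists_norm_eq_add_le [ProperSpace E] (hf : Differentiable ℝ f) {d : ℝ} (hd : 0 ≤ d)
    (hgrad : ∀ w, d < ‖gradient f w‖) (x : E) {r : ℝ} (hr : 0 ≤ r) :
    ∃ e : E, ‖e‖ = r ∧ f x + d * r ≤ f (x + e) := by
  obtain ⟨y, hy, hmax⟩ := (isCompact_closedBall x r).exists_isMaxOn
    ⟨x, Metric.mem_closedBall_self hr⟩
    (f := fun z => f z - d * ‖z - x‖)
    (hf.continuous.sub (by fun_prop)).continuousOn
  have hyr : ‖y - x‖ = r := by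
    refine le_antisymm (mem_closedBall_iff_norm.1 hy) (not_lt.1 fun hlt => ?_)
    exact not_isLocalMax_sub_mul_norm (hf y) hd (hgrad y) x
      (hmax.isLocalMax (mem_of_superset (Metric.isOpen_ball.mem_nhds (mem_ball_iff_norm.2 hlt))
        Metric.ball_subset_closedBall))
  refine ⟨y - x, hyr, ?_⟩
  have : f x - d * ‖x - x‖ ≤ f y - d * ‖y - x‖ := hmax (Metric.mem_closedBall_self hr)
  rw [hyr] at this
  simp only [sub_self, norm_zero, mul_zero, sub_zero] at this
  rw [add_sub_cancel]
  linarith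

/-- A differentiable function whose gradient has constant positive norm lies above each of its
tangent hyperplanes. -/
theorem add_inner_gradient_le [ProperSpace E] (hf : Differentiable ℝ f) (hc : 0 < c)
    (hgrad : ∀ w, ‖gradient f w‖ = c) (x w : E) :
    f x + ⟪gradient f x, w⟫ ≤ f (x + w) := by
  have hex : ∀ n : ℕ, ∃ e : E, ‖e‖ = 1 ∧ ∀ w : E,
      f x + c * ⟪e, w⟫ - (c + c * ‖w‖ ^ 2 / 2) * (1 / ((n : ℝ) + 1)) ≤ f (x + w) := by
    intro n
    obtain ⟨r, hr⟩ : ∃ r : ℝ, r = n + 1 := ⟨_, rfl⟩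
    rw [← hr]
    have hr1 : 1 ≤ r := by rw [hr]; linarith [n.cast_nonneg (α := ℝ)]
    have hr0 : 0 < r := by linarith
    have hd0 : 0 ≤ c * (1 - 1 / r ^ 2) := by
      refine mul_nonneg hc.le (sub_nonneg.2 ?_)
      rw [div_le_one (by positivity)]
      nlinarith
    have hdc : c * (1 - 1 / r ^ 2) < c := by
      have : 0 < c * (1 / r ^ 2) := by positivity
      linarith
    obtain ⟨y, hy, hfy⟩ := exists_norm_eq_add_le hf hd0 (fun w => (hgrad w).symm ▸ hdc) x hr0.le
    have he : ‖r⁻¹ • y‖ = 1 := by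
      rw [norm_smul, hy, norm_inv, Real.norm_of_nonneg hr0.le, inv_mul_cancel₀ hr0.ne']
    refine ⟨r⁻¹ • y, he, fun w => ?_⟩
    have h1 := norm_sub_smul_le he w hr0
    rw [smul_inv_smul₀ hr0.ne'] at h1
    have h2 := sub_le_of_norm_gradient_eq hf hgrad (x + w) (x + y)
    rw [add_sub_add_left_eq_sub, norm_sub_rev] at h2
    have h3 := mul_le_mul_of_nonneg_left h1 hc.le
    have h4 : c * (1 - 1 / r ^ 2) * r = c * r - c * (1 / r) := by
      field_simp
    have h5 : c * (r - ⟪r⁻¹ • y, w⟫ + ‖w‖ ^ 2 / (2 * r))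
        = c * r - c * ⟪r⁻¹ • y, w⟫ + c * ‖w‖ ^ 2 / 2 * (1 / r) := by
      field_simp
    linarith
  choose e he hew using hex
  obtain ⟨a, -, φ, hφ, hlim⟩ := (isCompact_sphere (0 : E) 1).tendsto_subseq
    (x := e) (fun n => by simpa using he n)
  have hsupp : ∀ w, f x + ⟪c • a, w⟫ ≤ f (x + w) := by
    intro w
    have hinner : Tendsto (fun n => ⟪e (φ n), w⟫) atTop (𝓝 ⟪a, w⟫) :=
      hlim.inner tendsto_const_nhds
    have hzero := (tendsto_one_div_add_atTop_nhds_zero_nat (𝕜 := ℝ)).comp hφ.tendsto_atTop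
    have hall := ((hinner.const_mul c).const_add (f x)).sub
      (hzero.const_mul (c + c * ‖w‖ ^ 2 / 2))
    rw [mul_zero, sub_zero] at hall
    rw [real_inner_smul_left]
    exact le_of_tendsto hall (Eventually.of_forall fun n => hew (φ n) w)
  have hmin : IsLocalMin (fun z => f z - InnerProductSpace.toDual ℝ E (c • a) z) x := by
    refine Eventually.of_forall fun z => ?_
    have := hsupp (z - x)
    rw [add_sub_cancel, inner_sub_right] at this
    simp only [InnerProductSpace.toDual_apply_apply]
    linarith
  have hder := hmin.hasFDerivAt_eq_zero
    ((hf x).hasGradientAt.hasFDerivAt.sub (ContinuousLinearMap.hasFDerivAt _))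
  rw [sub_eq_zero, (InnerProductSpace.toDual ℝ E).injective.eq_iff] at hder
  rw [hder]
  exact hsupp w

end ConstantGradientNorm

/-- If a differentiable `f : ℝ^p → ℝ` has gradient of constant Euclidean norm,
then `f` is affine: `f w = ⟪a, w⟫ + b`. -/
theorem stmt_0 (p : ℕ) (f : EuclideanSpace ℝ (Fin p) → ℝ)
    (hf : Differentiable ℝ f) (c : ℝ) (hc : 0 ≤ c)
    (hgrad : ∀ w, ‖gradient f w‖ = c) :
    ∃ (a : EuclideanSpace ℝ (Fin p)) (b : ℝ), ∀ w, f w = ⟪a, w⟫ + b := by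
  rcases hc.eq_or_lt with rfl | hc
  · refine ⟨0, f 0, fun w => ?_⟩
    have h1 := sub_le_of_norm_gradient_eq hf hgrad 0 w
    have h2 := sub_le_of_norm_gradient_eq hf hgrad w 0
    rw [inner_zero_left]
    linarith
  · have hneg : ∀ w, gradient (fun z => -f z) w = -gradient f w := fun w => by
      simp [gradient, fderiv_fun_neg]
    refine ⟨gradient f 0, f 0, fun w => ?_⟩
    have h1 := add_inner_gradient_le hf hc hgrad 0 w
    have h2 := add_inner_gradient_le hf.fun_neg hc
      (fun w => by rw [hneg, norm_neg, hgrad]) 0 w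
    rw [hneg, inner_neg_left] at h2
    rw [zero_add] at h1 h2
    linarith
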